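/- Let n > 2, and regard the permutations w_k^{(n−1,1)} as elements of S_n. Then in ℤ[x_1, …, x_n]: 𝔖_{s_{n−2}} · 𝔖_{w_1^{(n−1,1)}} = 𝔖_{w_1^{(n−1,1)} t_{1,n}} + 𝔖_{w_1^{(n−1,1)} t_{n−2,n−1}} (when n > 3); for each k with 2 ≤ k ≤ n−3, 𝔖_{s_{n−2}} · 𝔖_{w_k^{(n−1,1)}} = 𝔖_{w_k^{(n−1,1)} t_{n−k−1,n−1}} + 𝔖_{w_k^{(n−1,1)} t_{n−2,n}}; and 𝔖_{s_{n−2}} · 𝔖_{w_{n−2}^{(n−1,1)}} = 𝔖_{w_{n−2}^{(n−1,1)} t_{n−2,n}}. -/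

import Mathlib

open MvPolynomial Finset

/-- The product of simple transpositions `s_a s_{a-1} ⋯ s_b` (descending indices),
where `s_r` interchanges `r` and `r+1`; the empty product (when `a < b`) is the identity. -/
def sdesc (a b : ℕ) : Equiv.Perm ℕ :=
  (((List.range' b (a + 1 - b)).reverse).map (fun r => Equiv.swap r (r + 1))).prod

/-- The product of simple transpositions `s_a s_{a+1} ⋯ s_b` (ascending indices);
the empty product (when `b < a`) is the identity. -/
def sasc (a b : ℕ) : Equiv.Perm ℕ :=
  ((List.range' a (b + 1 - a)).map (fun r => Equiv.swap r (r + 1))).prod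

/-- The permutation `w_k^{(i,j)} = (s_{i-k} s_{i-k-1} ⋯ s_j)(s_{i-k+1} s_{i-k+2} ⋯ s_{i-1})`,
regarded as a permutation of `ℕ` (supported on `{1, …, n}`). -/
def wkij (i j k : ℕ) : Equiv.Perm ℕ := sdesc (i - k) j * sasc (i - k + 1) (i - 1)

/-- The longest element `w_0 = [n, n-1, …, 1]` of `S_n`, as a permutation of `ℕ`. -/
def revPerm (n : ℕ) : Equiv.Perm ℕ :=
  Function.Involutive.toPerm (fun x => if 1 ≤ x ∧ x ≤ n then n + 1 - x else x)
    (fun x => by simp only; split_ifs <;> omega)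

/-- The cycle `s_a s_{a+1} ⋯ s_{a+j-1}`; right multiplication by it moves the entry in
position `a` to position `a + j`. -/
def cyc (a : ℕ) : ℕ → Equiv.Perm ℕ
  | 0 => 1
  | j + 1 => cyc a j * Equiv.swap (a + j) (a + j + 1)

/-- The reversal of the positions `a, …, a + L - 1`. -/
def blockRev (a : ℕ) : ℕ → Equiv.Perm ℕ
  | 0 => 1
  | L + 1 => cyc a L * blockRev a L

/-- The permutation of positions moving the entries in positions `P - j + 1, …, P` to the right
past the `d` entries following them. -/
def blockMove (P d : ℕ) : ℕ → Equiv.Perm ℕ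
  | 0 => 1
  | j + 1 => blockMove P d j * cyc (P - j) d

lemma cyc_apply (a j x : ℕ) :
    cyc a j x = if a ≤ x ∧ x < a + j then x + 1 else if x = a + j then a else x := by
  induction j generalizing x with
  | zero => simp only [cyc, Equiv.Perm.one_apply]; split_ifs <;> omega
  | succ j ih =>
    simp only [cyc, Equiv.Perm.mul_apply, ih, Equiv.swap_apply_def]
    split_ifs <;> omega

lemma blockRev_apply (a L x : ℕ) :
    blockRev a L x = if a ≤ x ∧ x < a + L then 2 * a + L - 1 - x else x := by
  induction L generalizing x with
  | zero => simp only [blockRev, Equiv.Perm.one_apply]; split_ifs <;> omega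
  | succ L ih =>
    simp only [blockRev, Equiv.Perm.mul_apply, ih, cyc_apply]
    split_ifs <;> omega

lemma blockMove_apply (P d j x : ℕ) (hj : j ≤ P) :
    blockMove P d j x = if P - j < x ∧ x ≤ P - j + d then x + j
      else if P - j + d < x ∧ x ≤ P + d then x - d else x := by
  induction j generalizing x with
  | zero => simp only [blockMove, Equiv.Perm.one_apply]; split_ifs <;> omega
  | succ j ih =>
    simp only [blockMove, Equiv.Perm.mul_apply, ih _ (by omega : j ≤ P), cyc_apply]
    split_ifs <;> omega

lemma revPerm_apply (n x : ℕ) :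
    revPerm n x = if 1 ≤ x ∧ x ≤ n then n + 1 - x else x := rfl

lemma sasc_eq_cyc (a b : ℕ) : sasc a b = cyc a (b + 1 - a) := by
  unfold sasc
  induction b + 1 - a with
  | zero => simp [cyc]
  | succ j ih => simp [List.range'_concat, cyc, ih]

lemma sdesc_eq_cyc_inv (a b : ℕ) : sdesc a b = (cyc b (a + 1 - b))⁻¹ := by
  unfold sdesc
  induction a + 1 - b with
  | zero => simp [cyc]
  | succ j ih =>
    rw [List.range'_concat, List.reverse_append, List.map_append, List.prod_append, ih]
    simp [cyc]

/-- The permutation `w` is supported on `{1, …, n}`. -/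
def FixesOutside (n : ℕ) (w : Equiv.Perm ℕ) : Prop := ∀ x, x ∉ Finset.Icc 1 n → w x = x

/-- The descending recursion for Schubert polynomials of `S_n`. -/
def SchubertRec (n : ℕ) (S : Equiv.Perm ℕ → MvPolynomial ℕ ℤ) : Prop :=
  ∀ w : Equiv.Perm ℕ, FixesOutside n w →
    ∀ r, 1 ≤ r → r < n → w (r + 1) < w r →
      S w - rename (⇑(Equiv.swap r (r + 1))) (S w)
        = (X r - X (r + 1)) * S (w * Equiv.swap r (r + 1))

lemma FixesOutside.mul {n : ℕ} {u v : Equiv.Perm ℕ} (hu : FixesOutside n u)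
    (hv : FixesOutside n v) : FixesOutside n (u * v) := fun x hx => by
  rw [Equiv.Perm.mul_apply, hv x hx, hu x hx]

lemma fixesOutside_cyc {n a j : ℕ} (ha : 1 ≤ a) (h : a + j ≤ n) : FixesOutside n (cyc a j) := by
  intro x hx
  rw [Finset.mem_Icc] at hx
  rw [cyc_apply]; split_ifs <;> omega

lemma fixesOutside_blockRev {n a L : ℕ} (ha : 1 ≤ a) (h : a + L ≤ n + 1) :
    FixesOutside n (blockRev a L) := by
  intro x hx
  rw [Finset.mem_Icc] at hx
  rw [blockRev_apply]; split_ifs <;> omega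

lemma fixesOutside_revPerm (n : ℕ) : FixesOutside n (revPerm n) := by
  intro x hx
  rw [Finset.mem_Icc] at hx
  rw [revPerm_apply, if_neg hx]

lemma X_sub_X_succ_ne_zero (r : ℕ) : (X r - X (r + 1) : MvPolynomial ℕ ℤ) ≠ 0 := by
  rw [sub_ne_zero]
  intro h
  exact absurd (X_injective h) (by omega)

/-- Divided differences along a cycle: the polynomials `f 0, f 1, …` are obtained from each other
by the divided differences with indices `a, a + 1, …`. -/
lemma SchubertRec.S_cyc {n : ℕ} {S : Equiv.Perm ℕ → MvPolynomial ℕ ℤ} (hS : SchubertRec n S)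
    {w : Equiv.Perm ℕ} (hw : FixesOutside n w) {a j : ℕ} (ha : 1 ≤ a) (hj : a + j ≤ n)
    (hdesc : ∀ i < j, w (a + i + 1) < w a) (f : ℕ → MvPolynomial ℕ ℤ) (h0 : S w = f 0)
    (hf : ∀ i < j, f i - rename (⇑(Equiv.swap (a + i) (a + i + 1))) (f i)
      = (X (a + i) - X (a + i + 1)) * f (i + 1)) :
    S (w * cyc a j) = f j := by
  induction j with
  | zero => simpa [cyc] using h0
  | succ j ih =>
    have ih := ih (by omega) (fun i hi => hdesc i (by omega)) (fun i hi => hf i (by omega))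
    have h := hS (w * cyc a j) (hw.mul (fixesOutside_cyc ha (by omega))) (a + j)
      (by omega) (by omega) (by
        have h1 : cyc a j (a + j + 1) = a + j + 1 := by
          rw [cyc_apply]; split_ifs <;> omega
        have h2 : cyc a j (a + j) = a := by
          rw [cyc_apply]; split_ifs <;> omega
        rw [Equiv.Perm.mul_apply, Equiv.Perm.mul_apply, h1, h2]
        exact hdesc j (by omega))
    rw [ih, hf j (by omega)] at h
    rw [cyc, ← mul_assoc]
    exact (mul_left_cancel₀ (X_sub_X_succ_ne_zero _) h).symm

/-- The monomial in `x_1, …, x_n` with exponents `e`. -/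
noncomputable def mono (n : ℕ) (e : ℕ → ℕ) : MvPolynomial ℕ ℤ := ∏ r ∈ Finset.Icc 1 n, X r ^ e r

lemma mono_congr {n : ℕ} {e e' : ℕ → ℕ} (h : ∀ r, 1 ≤ r → r ≤ n → e r = e' r) :
    mono n e = mono n e' :=
  Finset.prod_congr rfl fun r hr => by
    rw [Finset.mem_Icc] at hr
    rw [h r hr.1 hr.2]

lemma rename_swap_mono {n r : ℕ} (hr : 1 ≤ r) (hrn : r < n) {e : ℕ → ℕ} (he : e r = e (r + 1)) :
    rename (⇑(Equiv.swap r (r + 1))) (mono n e) = mono n e := by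
  simp only [mono, map_prod, map_pow, rename_X]
  refine Finset.prod_equiv (Equiv.swap r (r + 1)) (fun i => ?_) (fun i _ => ?_)
  · simp only [Finset.mem_Icc, Equiv.swap_apply_def]
    split_ifs <;> omega
  · congr 1
    rw [Equiv.swap_apply_def]
    split_ifs with h1 h2
    · rw [h1, he]
    · rw [h2, he]
    · rfl

lemma mono_mul_X_pow {n r d : ℕ} (hr : 1 ≤ r) (hrn : r ≤ n) {e e' : ℕ → ℕ}
    (h : e r = e' r + d) (h' : ∀ i, 1 ≤ i → i ≠ r → e i = e' i) :
    mono n e = mono n e' * X r ^ d := by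
  have hmem : r ∈ Finset.Icc 1 n := by simp [hr, hrn]
  rw [mono, mono, ← Finset.mul_prod_erase _ _ hmem, ← Finset.mul_prod_erase _ _ hmem, h, pow_add,
    Finset.prod_congr rfl fun i hi => by
      rw [h' i (Finset.mem_Icc.1 (Finset.mem_of_mem_erase hi)).1 (Finset.ne_of_mem_erase hi)]]
  ring

lemma SchubertRec.S_cyc_mono {n : ℕ} {S : Equiv.Perm ℕ → MvPolynomial ℕ ℤ} (hS : SchubertRec n S)
    {w : Equiv.Perm ℕ} (hw : FixesOutside n w) {a j : ℕ} (ha : 1 ≤ a) (hj : a + j ≤ n)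
    (hdesc : ∀ i < j, w (a + i + 1) < w a) {e : ℕ → ℕ} (h0 : S w = mono n e)
    (he : ∀ i < j, e (a + i) = e (a + i + 1) + 1) :
    S (w * cyc a j) = mono n (fun r => if a ≤ r ∧ r < a + j then e r - 1 else e r) := by
  refine hS.S_cyc hw ha hj hdesc
    (fun i => mono n (fun r => if a ≤ r ∧ r < a + i then e r - 1 else e r)) ?_ ?_
  · rw [h0]
    exact mono_congr fun r _ _ => by split_ifs <;> omega
  · intro i hi
    have hei := he i hi
    have hsucc : mono n (fun r => if a ≤ r ∧ r < a + i then e r - 1 else e r)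
        = mono n (fun r => if a ≤ r ∧ r < a + (i + 1) then e r - 1 else e r) * X (a + i) ^ 1 := by
      refine mono_mul_X_pow (by omega) (by omega) ?_ ?_
      · split_ifs <;> omega
      · intro r _ hr
        split_ifs <;> omega
    have hsymm := rename_swap_mono (n := n) (r := a + i) (by omega) (by omega)
      (e := fun r => if a ≤ r ∧ r < a + (i + 1) then e r - 1 else e r)
      (by split_ifs <;> omega)
    rw [hsucc, map_mul, hsymm, map_pow, rename_X, Equiv.swap_apply_left]
    ring

/-- Sorting a decreasing block of entries into increasing order, on monomials. -/
lemma SchubertRec.S_blockRev_mono {n : ℕ} {S : Equiv.Perm ℕ → MvPolynomial ℕ ℤ}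
    (hS : SchubertRec n S) {w : Equiv.Perm ℕ} (hw : FixesOutside n w) {a L c : ℕ} (ha : 1 ≤ a)
    (hL : a + L ≤ n + 1) (hdesc : ∀ i j, i < j → j < L → w (a + j) < w (a + i)) {e : ℕ → ℕ}
    (h0 : S w = mono n e) (he : ∀ i < L, e (a + i) = c + (L - 1 - i)) :
    S (w * blockRev a L) = mono n (fun r => if a ≤ r ∧ r < a + L then c else e r) := by
  induction L generalizing w e with
  | zero =>
    rw [blockRev, mul_one, h0]
    exact mono_congr fun r _ _ => by split_ifs <;> omega
  | succ L ih =>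
    have h1 := hS.S_cyc_mono hw ha (j := L) (by omega)
      (fun i hi => hdesc 0 (i + 1) (by omega) (by omega)) h0
      (fun i hi => by rw [add_assoc, he i (by omega), he (i + 1) (by omega)]; omega)
    rw [blockRev, ← mul_assoc, ih (hw.mul (fixesOutside_cyc ha (by omega))) (by omega) ?_ h1 ?_]
    · refine mono_congr fun r _ _ => ?_
      rcases eq_or_ne r (a + L) with rfl | hr
      · have := he L (by omega)
        split_ifs <;> omega
      · split_ifs <;> omega
    · intro i j hij hj
      rw [Equiv.Perm.mul_apply, Equiv.Perm.mul_apply, cyc_apply, cyc_apply,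
        if_pos (by omega), if_pos (by omega)]
      exact hdesc (i + 1) (j + 1) (by omega) (by omega)
    · intro i hi
      have := he i (by omega)
      rw [if_pos (by omega)]
      omega

/-- The complete homogeneous symmetric polynomial of degree `t` in `x_a, …, x_{a+l-1}`. -/
noncomputable def hsym (a : ℕ) : ℕ → ℕ → MvPolynomial ℕ ℤ
  | 0, _ => 1
  | _ + 1, 0 => 0
  | t + 1, l + 1 => hsym a (t + 1) l + X (a + l) * hsym a t (l + 1)

lemma hsym_succ_succ (a t l : ℕ) :
    hsym a (t + 1) (l + 1) = hsym a (t + 1) l + X (a + l) * hsym a t (l + 1) := by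
  rw [hsym]

lemma rename_swap_hsym (a t l r : ℕ) (h : a + l ≤ r) :
    rename (⇑(Equiv.swap r (r + 1))) (hsym a t l) = hsym a t l := by
  induction t generalizing l with
  | zero => simp [hsym]
  | succ t iht =>
    induction l with
    | zero => simp [hsym]
    | succ l ihl =>
      rw [hsym, map_add, map_mul, rename_X, ihl (by omega), iht _ h,
        Equiv.swap_apply_of_ne_of_ne (by omega) (by omega)]

lemma hsym_sub_rename (a t l : ℕ) :
    hsym a (t + 1) (l + 1) - rename (⇑(Equiv.swap (a + l) (a + l + 1))) (hsym a (t + 1) (l + 1))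
      = (X (a + l) - X (a + l + 1)) * hsym a t (l + 2) := by
  have hstep (t : ℕ) : rename (⇑(Equiv.swap (a + l) (a + l + 1))) (hsym a (t + 1) (l + 1))
      = hsym a (t + 1) l + X (a + l + 1) *
        rename (⇑(Equiv.swap (a + l) (a + l + 1))) (hsym a t (l + 1)) := by
    rw [hsym_succ_succ, map_add, map_mul, rename_swap_hsym _ _ _ _ le_rfl, rename_X,
      Equiv.swap_apply_left]
  induction t with
  | zero =>
    rw [hstep, hsym_succ_succ]
    simp [hsym]
  | succ t ih =>
    rw [hstep, hsym_succ_succ a (t + 1) l, hsym_succ_succ a t (l + 1), ← add_assoc a l 1]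
    linear_combination X (a + l + 1) * ih

lemma hsym_one_right (a t : ℕ) : hsym a t 1 = X a ^ t := by
  induction t with
  | zero => simp [hsym]
  | succ t ih => rw [hsym, ih, pow_succ']; simp [hsym]

lemma hsym_one_left (a l : ℕ) : hsym a 1 l = ∑ i ∈ Finset.range l, X (a + i) := by
  induction l with
  | zero => simp [hsym]
  | succ l ih => rw [hsym, ih, Finset.sum_range_succ]; simp [hsym]

lemma SchubertRec.S_cyc_hsym {n : ℕ} {S : Equiv.Perm ℕ → MvPolynomial ℕ ℤ} (hS : SchubertRec n S)
    {w : Equiv.Perm ℕ} (hw : FixesOutside n w) {a j : ℕ} (ha : 1 ≤ a) (hj : a + j ≤ n)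
    (hdesc : ∀ i < j, w (a + i + 1) < w a) {M : MvPolynomial ℕ ℤ}
    (h0 : S w = M * X a ^ (j + 1))
    (hM : ∀ i < j, rename (⇑(Equiv.swap (a + i) (a + i + 1))) M = M) :
    S (w * cyc a j) = M * ∑ i ∈ Finset.range (j + 1), X (a + i) := by
  rw [hS.S_cyc hw ha hj hdesc (fun i => M * hsym a (j + 1 - i) (i + 1)) ?_ ?_, ← hsym_one_left]
  · simp
  · simp [h0, hsym_one_right]
  · intro i hi
    rw [map_mul, hM i hi, ← mul_sub, show j + 1 - i = (j - i) + 1 by omega, hsym_sub_rename,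
      show j + 1 - (i + 1) = j - i by omega]
    ring

/-- The permutation `[n-1, n-2, …, 1, n]`. -/
def prevRevPerm (n : ℕ) : Equiv.Perm ℕ := revPerm n * cyc 1 (n - 1)

lemma prevRevPerm_apply (n x : ℕ) :
    prevRevPerm n x = if 1 ≤ x ∧ x < n then n - x else x := by
  simp only [prevRevPerm, Equiv.Perm.mul_apply, cyc_apply, revPerm_apply]
  split_ifs <;> omega

lemma fixesOutside_prevRevPerm {n : ℕ} (hn : 1 ≤ n) : FixesOutside n (prevRevPerm n) :=
  (fixesOutside_revPerm n).mul (fixesOutside_cyc le_rfl (by omega))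

lemma SchubertRec.S_prevRevPerm {n : ℕ} {S : Equiv.Perm ℕ → MvPolynomial ℕ ℤ}
    (hS : SchubertRec n S) (hn : 1 ≤ n) (h0 : S (revPerm n) = mono n (fun r => n - r)) :
    S (prevRevPerm n) = mono n (fun r => n - 1 - r) := by
  rw [prevRevPerm, hS.S_cyc_mono (fixesOutside_revPerm n) le_rfl (by omega) ?_ h0 ?_]
  · exact mono_congr fun r _ _ => by split_ifs <;> omega
  · intro i hi
    simp only [revPerm_apply]; split_ifs <;> omega
  · intro i hi
    omega

/-- The permutation `[m+1, …, m+P | 1, …, m | n]` with `n = P + m + 1`. -/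
def rectPerm (P m : ℕ) : Equiv.Perm ℕ :=
  prevRevPerm (P + m + 1) * blockRev 1 P * blockRev (P + 1) m

lemma rectPerm_apply (P m x : ℕ) :
    rectPerm P m x = if 1 ≤ x ∧ x ≤ P then m + x else if P < x ∧ x ≤ P + m then x - P else x := by
  simp only [rectPerm, Equiv.Perm.mul_apply, blockRev_apply, prevRevPerm_apply]
  split_ifs <;> omega

lemma fixesOutside_rectPerm (P m : ℕ) : FixesOutside (P + m + 1) (rectPerm P m) :=
  ((fixesOutside_prevRevPerm (by omega)).mul (fixesOutside_blockRev le_rfl (by omega))).mul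
    (fixesOutside_blockRev (by omega) (by omega))

lemma SchubertRec.S_rectPerm {P m : ℕ} {S : Equiv.Perm ℕ → MvPolynomial ℕ ℤ}
    (hS : SchubertRec (P + m + 1) S)
    (h0 : S (revPerm (P + m + 1)) = mono (P + m + 1) (fun r => P + m + 1 - r)) :
    S (rectPerm P m) = mono (P + m + 1) (fun r => if r ≤ P then m else 0) := by
  have hw := fixesOutside_prevRevPerm (n := P + m + 1) (by omega)
  have h1 := hS.S_blockRev_mono hw (a := 1) (L := P) (c := m) le_rfl (by omega)
    (by intro i j _ _; simp only [prevRevPerm_apply]; split_ifs <;> omega)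
    (hS.S_prevRevPerm (by omega) h0) (by intro i hi; omega)
  have h2 := hS.S_blockRev_mono (hw.mul (fixesOutside_blockRev le_rfl (by omega)))
    (a := P + 1) (L := m) (c := 0) (by omega) (by omega)
    (by
      intro i j _ _
      simp only [Equiv.Perm.mul_apply, blockRev_apply, prevRevPerm_apply]
      split_ifs <;> omega)
    h1 (by intro i hi; split_ifs <;> omega)
  rw [rectPerm, h2]
  exact mono_congr fun r _ _ => by split_ifs <;> omega

/-- The permutation `[m+1, …, m+P | 1, …, m-2, m | m-1, n]` with `n = P + m + 1`. -/
def rectPermRight (P m : ℕ) : Equiv.Perm ℕ :=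
  prevRevPerm (P + m + 1) * blockRev 1 P * blockRev (P + 2) (m - 1) * cyc (P + 1) (m - 2)

lemma rectPermRight_apply {P m : ℕ} (hm : 2 ≤ m) (x : ℕ) :
    rectPermRight P m x = if 1 ≤ x ∧ x ≤ P then m + x
      else if P < x ∧ x + 2 ≤ P + m then x - P
      else if x + 1 = P + m then m else if x = P + m then m - 1 else x := by
  have h1 (x : ℕ) : (prevRevPerm (P + m + 1) * blockRev 1 P) x = if 1 ≤ x ∧ x ≤ P then m + x
      else if P < x ∧ x ≤ P + m then P + m + 1 - x else x := by
    simp only [Equiv.Perm.mul_apply, blockRev_apply, prevRevPerm_apply]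
    split_ifs <;> omega
  rw [rectPermRight, Equiv.Perm.mul_apply, Equiv.Perm.mul_apply, h1, blockRev_apply, cyc_apply]
  split_ifs <;> omega

lemma rectPermRight_eq {P m : ℕ} (hm : 2 ≤ m) :
    rectPermRight P m = rectPerm P m * Equiv.swap (P + m - 1) (P + m) := by
  ext x
  rw [Equiv.Perm.mul_apply, rectPerm_apply, rectPermRight_apply hm, Equiv.swap_apply_def]
  split_ifs <;> omega

lemma SchubertRec.S_rectPermRight {P m : ℕ} {S : Equiv.Perm ℕ → MvPolynomial ℕ ℤ}
    (hS : SchubertRec (P + m + 1) S)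
    (h0 : S (revPerm (P + m + 1)) = mono (P + m + 1) (fun r => P + m + 1 - r)) (hm : 2 ≤ m) :
    S (rectPermRight P m) = mono (P + m + 1) (fun r => if r ≤ P then m else 0) *
      ∑ i ∈ Finset.range (m - 1), X (P + 1 + i) := by
  have hw := fixesOutside_prevRevPerm (n := P + m + 1) (by omega)
  have h1 := hS.S_blockRev_mono hw (a := 1) (L := P) (c := m) le_rfl (by omega)
    (by intro i j _ _; simp only [prevRevPerm_apply]; split_ifs <;> omega)
    (hS.S_prevRevPerm (by omega) h0) (by intro i hi; omega)
  have h2 := hS.S_blockRev_mono (hw.mul (fixesOutside_blockRev le_rfl (by omega)))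
    (a := P + 2) (L := m - 1) (c := 0) (by omega) (by omega)
    (by
      intro i j _ _
      simp only [Equiv.Perm.mul_apply, blockRev_apply, prevRevPerm_apply]
      split_ifs <;> omega)
    h1 (by intro i hi; split_ifs <;> omega)
  have h3 := hS.S_cyc_hsym ((hw.mul (fixesOutside_blockRev (a := 1) (L := P) le_rfl
      (by omega))).mul (fixesOutside_blockRev (a := P + 2) (L := m - 1) (by omega) (by omega)))
    (a := P + 1) (j := m - 2) (by omega) (by omega)
    (by
      intro i hi
      simp only [Equiv.Perm.mul_apply, blockRev_apply, prevRevPerm_apply]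
      split_ifs <;> omega)
    (M := mono (P + m + 1) (fun r => if r ≤ P then m else 0))
    (by
      rw [h2]
      refine mono_mul_X_pow (by omega) (by omega) ?_ ?_
      · split_ifs <;> omega
      · intro i _ hi
        split_ifs <;> omega)
    (fun i hi => rename_swap_mono (by omega) (by omega) (by split_ifs <;> omega))
  rw [rectPermRight, h3, show m - 2 + 1 = m - 1 by omega]

/-- The permutation `[m+1, …, m+P-1, n | 1, …, m | m+P]` with `n = P + m + 1`. -/
def rectPermTop (P m : ℕ) : Equiv.Perm ℕ :=
  revPerm (P + m + 1) * cyc 2 (P + m - 1) * blockRev 2 (P - 1) * blockRev (P + 1) m *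
    cyc 1 (P - 1)

lemma revPerm_mul_cyc_two_apply {P m : ℕ} (hP : 1 ≤ P) (x : ℕ) :
    (revPerm (P + m + 1) * cyc 2 (P + m - 1)) x = if x = 1 then P + m + 1
      else if 1 < x ∧ x ≤ P + m then P + m + 1 - x
      else if x = P + m + 1 then P + m else x := by
  simp only [Equiv.Perm.mul_apply, cyc_apply, revPerm_apply]
  split_ifs <;> omega

lemma revPerm_mul_cyc_two_mul_blockRev_apply {P m : ℕ} (hP : 1 ≤ P) (x : ℕ) :
    (revPerm (P + m + 1) * cyc 2 (P + m - 1) * blockRev 2 (P - 1)) x =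
      if x = 1 then P + m + 1 else if 1 < x ∧ x ≤ P then m + x - 1
      else if 1 < x ∧ x ≤ P + m then P + m + 1 - x
      else if x = P + m + 1 then P + m else x := by
  rw [Equiv.Perm.mul_apply, revPerm_mul_cyc_two_apply hP, blockRev_apply]
  split_ifs <;> omega

lemma rectPermTop_apply {P m : ℕ} (hP : 1 ≤ P) (x : ℕ) :
    rectPermTop P m x = if 1 ≤ x ∧ x < P then m + x
      else if x = P then P + m + 1
      else if P < x ∧ x ≤ P + m then x - P else if x = P + m + 1 then P + m else x := by
  rw [rectPermTop, Equiv.Perm.mul_apply, Equiv.Perm.mul_apply,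
    revPerm_mul_cyc_two_mul_blockRev_apply hP, blockRev_apply, cyc_apply]
  split_ifs <;> omega

lemma rectPermTop_eq {P m : ℕ} (hP : 1 ≤ P) :
    rectPermTop P m = rectPerm P m * Equiv.swap P (P + m + 1) := by
  ext x
  rw [Equiv.Perm.mul_apply, rectPerm_apply, rectPermTop_apply hP, Equiv.swap_apply_def]
  split_ifs <;> omega

lemma SchubertRec.S_rectPermTop {P m : ℕ} {S : Equiv.Perm ℕ → MvPolynomial ℕ ℤ}
    (hS : SchubertRec (P + m + 1) S)
    (h0 : S (revPerm (P + m + 1)) = mono (P + m + 1) (fun r => P + m + 1 - r)) (hP : 1 ≤ P) :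
    S (rectPermTop P m) = mono (P + m + 1) (fun r => if r ≤ P then m else 0) *
      ∑ i ∈ Finset.range P, X (1 + i) := by
  have hw0 := fixesOutside_revPerm (P + m + 1)
  have hw1 := hw0.mul (fixesOutside_cyc (a := 2) (j := P + m - 1) (by omega) (by omega))
  have hw2 := hw1.mul (fixesOutside_blockRev (a := 2) (L := P - 1) (by omega) (by omega))
  have hw3 := hw2.mul (fixesOutside_blockRev (a := P + 1) (L := m) (by omega) (by omega))
  have h1 := hS.S_cyc_mono hw0 (a := 2) (j := P + m - 1) (by omega) (by omega)
    (by intro i _; simp only [revPerm_apply]; split_ifs <;> omega) h0 (by intro i hi; omega)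
  have h2 := hS.S_blockRev_mono hw1 (a := 2) (L := P - 1) (c := m) (by omega) (by omega)
    (by
      intro i j _ _
      rw [revPerm_mul_cyc_two_apply hP, revPerm_mul_cyc_two_apply hP]
      split_ifs <;> omega)
    h1 (by intro i hi; split_ifs <;> omega)
  have h3 := hS.S_blockRev_mono hw2 (a := P + 1) (L := m) (c := 0) (by omega) (by omega)
    (by
      intro i j _ _
      rw [revPerm_mul_cyc_two_mul_blockRev_apply hP, revPerm_mul_cyc_two_mul_blockRev_apply hP]
      split_ifs <;> omega)
    h2 (by intro i hi; split_ifs <;> omega)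
  have h4 := hS.S_cyc_hsym hw3 (a := 1) (j := P - 1) (by omega) (by omega)
    (by
      intro i hi
      rw [Equiv.Perm.mul_apply _ (blockRev (P + 1) m), Equiv.Perm.mul_apply _ (blockRev (P + 1) m),
        revPerm_mul_cyc_two_mul_blockRev_apply hP, revPerm_mul_cyc_two_mul_blockRev_apply hP,
        blockRev_apply, blockRev_apply]
      split_ifs <;> omega)
    (M := mono (P + m + 1) (fun r => if r ≤ P then m else 0))
    (by
      rw [h3]
      refine mono_mul_X_pow (by omega) (by omega) ?_ ?_
      · split_ifs <;> omega
      · intro i _ hi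
        split_ifs <;> omega)
    (fun i hi => rename_swap_mono (by omega) (by omega) (by split_ifs <;> omega))
  rw [rectPermTop, h4, show P - 1 + 1 = P by omega]

lemma fixesOutside_swap {n r : ℕ} (hr : 1 ≤ r) (hrn : r < n) :
    FixesOutside n (Equiv.swap r (r + 1)) := by
  intro x hx
  rw [Finset.mem_Icc] at hx
  exact Equiv.swap_apply_of_ne_of_ne (by omega) (by omega)

/-- A product formula persists under divided differences for which the left factor is symmetric. -/
lemma SchubertRec.mul_eq_add_step {n : ℕ} {S : Equiv.Perm ℕ → MvPolynomial ℕ ℤ}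
    (hS : SchubertRec n S) {f : MvPolynomial ℕ ℤ} {x y z : Equiv.Perm ℕ} (hx : FixesOutside n x)
    (hy : FixesOutside n y) (hz : FixesOutside n z) {r : ℕ} (hr : 1 ≤ r) (hrn : r < n)
    (hf : rename (⇑(Equiv.swap r (r + 1))) f = f) (hdx : x (r + 1) < x r)
    (hdy : y (r + 1) < y r) (hdz : z (r + 1) < z r) (h : f * S x = S y + S z) :
    f * S (x * Equiv.swap r (r + 1)) =
      S (y * Equiv.swap r (r + 1)) + S (z * Equiv.swap r (r + 1)) := by
  have h' := congrArg (rename (⇑(Equiv.swap r (r + 1)))) h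
  rw [map_mul, map_add, hf] at h'
  apply mul_left_cancel₀ (X_sub_X_succ_ne_zero r)
  linear_combination h - h' - f * hS x hx r hr hrn hdx + hS y hy r hr hrn hdy
    + hS z hz r hr hrn hdz

lemma SchubertRec.mul_eq_add_cyc {n : ℕ} {S : Equiv.Perm ℕ → MvPolynomial ℕ ℤ}
    (hS : SchubertRec n S) {f : MvPolynomial ℕ ℤ} {x y z : Equiv.Perm ℕ} (hx : FixesOutside n x)
    (hy : FixesOutside n y) (hz : FixesOutside n z) {a j : ℕ} (ha : 1 ≤ a) (hj : a + j ≤ n)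
    (hf : ∀ i < j, rename (⇑(Equiv.swap (a + i) (a + i + 1))) f = f)
    (hdx : ∀ i < j, x (a + i + 1) < x a) (hdy : ∀ i < j, y (a + i + 1) < y a)
    (hdz : ∀ i < j, z (a + i + 1) < z a) (h : f * S x = S y + S z) :
    f * S (x * cyc a j) = S (y * cyc a j) + S (z * cyc a j) := by
  induction j with
  | zero => simpa [cyc] using h
  | succ j ih =>
    have ih := ih (by omega) (fun i hi => hf i (by omega)) (fun i hi => hdx i (by omega))
      (fun i hi => hdy i (by omega)) (fun i hi => hdz i (by omega))
    have hc := fixesOutside_cyc (n := n) (a := a) (j := j) ha (by omega)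
    have h1 : cyc a j (a + j + 1) = a + j + 1 := by
      rw [cyc_apply]; split_ifs <;> omega
    have h2 : cyc a j (a + j) = a := by
      rw [cyc_apply]; split_ifs <;> omega
    simp only [cyc, ← mul_assoc]
    refine hS.mul_eq_add_step (hx.mul hc) (hy.mul hc) (hz.mul hc) (by omega) (by omega)
      (hf j (by omega)) ?_ ?_ ?_ ih
    all_goals rw [Equiv.Perm.mul_apply, Equiv.Perm.mul_apply, h1, h2]
    exacts [hdx j (by omega), hdy j (by omega), hdz j (by omega)]

lemma fixesOutside_blockMove {n P d j : ℕ} (hj : j ≤ P) (hn : P + d ≤ n) :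
    FixesOutside n (blockMove P d j) := by
  intro x hx
  rw [Finset.mem_Icc] at hx
  rw [blockMove_apply _ _ _ _ hj]; split_ifs <;> omega

lemma SchubertRec.mul_eq_add_blockMove {n : ℕ} {S : Equiv.Perm ℕ → MvPolynomial ℕ ℤ}
    (hS : SchubertRec n S) {f : MvPolynomial ℕ ℤ} {x y z : Equiv.Perm ℕ} (hx : FixesOutside n x)
    (hy : FixesOutside n y) (hz : FixesOutside n z) {P d j : ℕ} (hj : j < P) (hn : P + d ≤ n)
    (hf : ∀ r, 1 ≤ r → r < P + d → rename (⇑(Equiv.swap r (r + 1))) f = f)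
    (hdx : ∀ p q, 1 ≤ p → p ≤ P → P < q → q ≤ P + d → P < p + j → x q < x p)
    (hdy : ∀ p q, 1 ≤ p → p ≤ P → P < q → q ≤ P + d → P < p + j → y q < y p)
    (hdz : ∀ p q, 1 ≤ p → p ≤ P → P < q → q ≤ P + d → P < p + j → z q < z p)
    (h : f * S x = S y + S z) :
    f * S (x * blockMove P d j) = S (y * blockMove P d j) + S (z * blockMove P d j) := by
  induction j with
  | zero => simpa [blockMove] using h
  | succ j ih =>
    have ih := ih (by omega) (fun p q h1 h2 h3 h4 h5 => hdx p q h1 h2 h3 h4 (by omega))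
      (fun p q h1 h2 h3 h4 h5 => hdy p q h1 h2 h3 h4 (by omega))
      (fun p q h1 h2 h3 h4 h5 => hdz p q h1 h2 h3 h4 (by omega))
    have hb := fixesOutside_blockMove (n := n) (P := P) (d := d) (j := j) (by omega) hn
    have hmove (w : Equiv.Perm ℕ)
        (hw : ∀ p q, 1 ≤ p → p ≤ P → P < q → q ≤ P + d → P < p + (j + 1) → w q < w p) :
        ∀ i < d, (w * blockMove P d j) (P - j + i + 1) < (w * blockMove P d j) (P - j) := by
      intro i hi
      have h1 : blockMove P d j (P - j + i + 1) = P + i + 1 := by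
        rw [blockMove_apply _ _ _ _ (by omega)]; split_ifs <;> omega
      have h2 : blockMove P d j (P - j) = P - j := by
        rw [blockMove_apply _ _ _ _ (by omega)]; split_ifs <;> omega
      rw [Equiv.Perm.mul_apply, Equiv.Perm.mul_apply, h1, h2]
      exact hw _ _ (by omega) (by omega) (by omega) (by omega) (by omega)
    simp only [blockMove, ← mul_assoc]
    exact hS.mul_eq_add_cyc (hx.mul hb) (hy.mul hb) (hz.mul hb) (by omega) (by omega)
      (fun i hi => hf _ (by omega) (by omega)) (hmove x hdx) (hmove y hdy) (hmove z hdz) ih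

lemma rename_swap_sum_X {N r : ℕ} (hr : 1 ≤ r) (hrN : r < N) :
    rename (⇑(Equiv.swap r (r + 1))) (∑ i ∈ Finset.range N, X (1 + i) : MvPolynomial ℕ ℤ)
      = ∑ i ∈ Finset.range N, X (1 + i) := by
  have hsum : (∑ i ∈ Finset.range N, X (1 + i) : MvPolynomial ℕ ℤ) = ∑ i ∈ Finset.Icc 1 N, X i := by
    rw [Finset.range_eq_Ico, Finset.sum_Ico_add (fun i => (X i : MvPolynomial ℕ ℤ)) 0 N 1]
    rfl
  rw [hsum, map_sum]
  simp only [rename_X]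
  refine Finset.sum_equiv (Equiv.swap r (r + 1)) (fun i => ?_) (fun i _ => rfl)
  simp only [Finset.mem_Icc, Equiv.swap_apply_def]
  split_ifs <;> omega

lemma SchubertRec.S_swap {m : ℕ} {S : Equiv.Perm ℕ → MvPolynomial ℕ ℤ}
    (hS : SchubertRec (m + 1) S)
    (h0 : S (revPerm (m + 1)) = mono (m + 1) (fun r => m + 1 - r)) (hm : 2 ≤ m) :
    S (Equiv.swap (m - 1) m) = ∑ i ∈ Finset.range (m - 1), X (1 + i) := by
  have h := SchubertRec.S_rectPermRight (P := 0) (m := m) (by simpa using hS) (by simpa using h0) hm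
  have h1 : rectPerm 0 m = 1 := by
    ext x
    rw [rectPerm_apply, Equiv.Perm.one_apply]; split_ifs <;> omega
  have h2 : mono (0 + m + 1) (fun r => if r ≤ 0 then m else 0) = 1 :=
    Finset.prod_eq_one fun r hr => by
      rw [Finset.mem_Icc] at hr
      dsimp only
      rw [if_neg (by omega), pow_zero]
  rw [h2, rectPermRight_eq hm, h1] at h
  simpa using h

lemma wkij_eq {P m : ℕ} (hP : 1 ≤ P) (hm : 1 ≤ m) :
    wkij (P + m + 1 - 1) 1 P = rectPerm P m * blockMove P (m - 1) (P - 1) := by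
  rw [wkij, sdesc_eq_cyc_inv, sasc_eq_cyc, inv_mul_eq_iff_eq_mul]
  ext x
  have h1 : (rectPerm P m * blockMove P (m - 1) (P - 1)) x = if x = 1 then m + 1
      else if 1 < x ∧ x ≤ m then x - 1 else if m < x ∧ x < P + m then x + 1
      else if x = P + m then m else x := by
    rw [Equiv.Perm.mul_apply, rectPerm_apply, blockMove_apply _ _ _ _ (by omega)]
    split_ifs <;> omega
  rw [Equiv.Perm.mul_apply, h1, cyc_apply, cyc_apply]
  split_ifs <;> omega

lemma rectPerm_mul_swap_mul {P m a b : ℕ} (u : Equiv.Perm ℕ) :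
    rectPerm P m * Equiv.swap (u a) (u b) * u = rectPerm P m * u * Equiv.swap a b := by
  rw [mul_assoc, mul_assoc, Equiv.mul_swap_eq_swap_mul]

lemma rectPermTop_mul_blockMove {P m : ℕ} (hP : 2 ≤ P ∨ m = 1) (hP1 : 1 ≤ P) (hm : 1 ≤ m) :
    rectPermTop P m * blockMove P (m - 1) (P - 1) =
      wkij (P + m + 1 - 1) 1 P * Equiv.swap (P + m - 1) (P + m + 1) := by
  have h1 : blockMove P (m - 1) (P - 1) (P + m - 1) = P := by
    rw [blockMove_apply _ _ _ _ (by omega)]; split_ifs <;> omega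
  have h2 : blockMove P (m - 1) (P - 1) (P + m + 1) = P + m + 1 := by
    rw [blockMove_apply _ _ _ _ (by omega)]; split_ifs <;> omega
  rw [rectPermTop_eq hP1, wkij_eq hP1 hm, ← rectPerm_mul_swap_mul, h1, h2]

lemma rectPermRight_mul_blockMove {P m : ℕ} (hP : 1 ≤ P) (hm : 2 ≤ m) :
    rectPermRight P m * blockMove P (m - 1) (P - 1) =
      wkij (P + m + 1 - 1) 1 P * Equiv.swap m (P + m) := by
  have h1 : blockMove P (m - 1) (P - 1) m = P + m - 1 := by
    rw [blockMove_apply _ _ _ _ (by omega)]; split_ifs <;> omega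
  have h2 : blockMove P (m - 1) (P - 1) (P + m) = P + m := by
    rw [blockMove_apply _ _ _ _ (by omega)]; split_ifs <;> omega
  rw [rectPermRight_eq hm, wkij_eq hP (by omega), ← rectPerm_mul_swap_mul, h1, h2]

lemma SchubertRec.S_swap_mul_wkij {P m : ℕ} {S : Equiv.Perm ℕ → MvPolynomial ℕ ℤ}
    (hS : SchubertRec (P + m + 1) S)
    (h0 : S (revPerm (P + m + 1)) = mono (P + m + 1) (fun r => P + m + 1 - r)) (hP : 1 ≤ P)
    (hm : 2 ≤ m) :
    S (Equiv.swap (P + m - 1) (P + m)) * S (wkij (P + m + 1 - 1) 1 P) =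
      S (rectPermTop P m * blockMove P (m - 1) (P - 1)) +
        S (wkij (P + m + 1 - 1) 1 P * Equiv.swap m (P + m)) := by
  have hw := fixesOutside_rectPerm P m
  have htop : FixesOutside (P + m + 1) (rectPermTop P m) := fun x hx => by
    rw [Finset.mem_Icc] at hx
    rw [rectPermTop_apply hP]; split_ifs <;> omega
  have hright : FixesOutside (P + m + 1) (rectPermRight P m) := fun x hx => by
    rw [Finset.mem_Icc] at hx
    rw [rectPermRight_apply hm]; split_ifs <;> omega
  rw [← rectPermRight_mul_blockMove hP hm, wkij_eq hP (by omega), hS.S_swap h0 (by omega)]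
  refine hS.mul_eq_add_blockMove hw htop hright (by omega) (by omega)
    (fun r hr hr' => rename_swap_sum_X hr (by omega)) ?_ ?_ ?_ ?_
  · intro p q _ _ _ _ _
    rw [rectPerm_apply, rectPerm_apply]; split_ifs <;> omega
  · intro p q _ _ _ _ _
    rw [rectPermTop_apply hP, rectPermTop_apply hP]; split_ifs <;> omega
  · intro p q _ _ _ _ _
    rw [rectPermRight_apply hm, rectPermRight_apply hm]; split_ifs <;> omega
  · rw [hS.S_rectPerm h0, hS.S_rectPermTop h0 hP, hS.S_rectPermRight h0 hm,
      show P + m - 1 = P + (m - 1) by omega, Finset.sum_range_add, ← mul_add, mul_comm]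
    simp only [add_assoc, add_comm, add_left_comm]

lemma SchubertRec.S_swap_mul_wkij_one {P : ℕ} {S : Equiv.Perm ℕ → MvPolynomial ℕ ℤ}
    (hS : SchubertRec (P + 1 + 1) S)
    (h0 : S (revPerm (P + 1 + 1)) = mono (P + 1 + 1) (fun r => P + 1 + 1 - r)) (hP : 1 ≤ P) :
    S (Equiv.swap P (P + 1)) * S (wkij (P + 1) 1 P) =
      S (wkij (P + 1) 1 P * Equiv.swap P (P + 1 + 1)) := by
  have hid : blockMove P (1 - 1) (P - 1) = 1 := by
    ext x
    rw [blockMove_apply _ _ _ _ (by omega), Equiv.Perm.one_apply]; split_ifs <;> omega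
  have h1 := rectPermTop_mul_blockMove (P := P) (m := 1) (.inr rfl) hP le_rfl
  have h2 := wkij_eq (P := P) (m := 1) hP le_rfl
  have h3 := hS.S_swap h0 (by omega)
  rw [hid, mul_one] at h1 h2
  simp only [Nat.add_sub_cancel] at h1 h2 h3
  rw [← h1, h2, h3, hS.S_rectPerm h0, hS.S_rectPermTop h0 hP, mul_comm]

/-- Case (ii) in the proof of Proposition 3.2.  For `n > 2`, in
`ℤ[x_1, …, x_n]`:
`𝔖_{s_{n-2}} · 𝔖_{w_1^{(n-1,1)}} = 𝔖_{w_1^{(n-1,1)} t_{1,n}} + 𝔖_{w_1^{(n-1,1)} t_{n-2,n-1}}`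
(when `n > 3`); for `2 ≤ k ≤ n-3`,
`𝔖_{s_{n-2}} · 𝔖_{w_k^{(n-1,1)}} = 𝔖_{w_k^{(n-1,1)} t_{n-k-1,n-1}} + 𝔖_{w_k^{(n-1,1)} t_{n-2,n}}`;
and `𝔖_{s_{n-2}} · 𝔖_{w_{n-2}^{(n-1,1)}} = 𝔖_{w_{n-2}^{(n-1,1)} t_{n-2,n}}`.
The Schubert polynomials are encoded as any family `S` satisfying their defining
properties (`hS0`, `hSrec`). -/
theorem stmt7 (n : ℕ) (hn : 2 < n)
    (S : Equiv.Perm ℕ → MvPolynomial ℕ ℤ)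
    (hS0 : S (revPerm n) = ∏ r ∈ Finset.Icc 1 (n - 1), X r ^ (n - r))
    (hSrec : ∀ w : Equiv.Perm ℕ, (∀ x, x ∉ Finset.Icc 1 n → w x = x) →
      ∀ r, 1 ≤ r → r < n → w (r + 1) < w r →
        S w - rename (⇑(Equiv.swap r (r + 1))) (S w)
          = (X r - X (r + 1)) * S (w * Equiv.swap r (r + 1))) :
    (3 < n →
      S (Equiv.swap (n - 2) (n - 1)) * S (wkij (n - 1) 1 1)
        = S (wkij (n - 1) 1 1 * Equiv.swap 1 n)
          + S (wkij (n - 1) 1 1 * Equiv.swap (n - 2) (n - 1))) ∧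
    (∀ k, 2 ≤ k → k ≤ n - 3 →
      S (Equiv.swap (n - 2) (n - 1)) * S (wkij (n - 1) 1 k)
        = S (wkij (n - 1) 1 k * Equiv.swap (n - k - 1) (n - 1))
          + S (wkij (n - 1) 1 k * Equiv.swap (n - 2) n)) ∧
    S (Equiv.swap (n - 2) (n - 1)) * S (wkij (n - 1) 1 (n - 2))
      = S (wkij (n - 1) 1 (n - 2) * Equiv.swap (n - 2) n) := by
  have h0 : S (revPerm n) = mono n (fun r => n - r) := by
    obtain ⟨N, rfl⟩ : ∃ N, n = N + 1 := ⟨n - 1, by omega⟩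
    rw [hS0, mono, Finset.prod_Icc_succ_top (by omega)]
    simp
  have hS : SchubertRec n S := hSrec
  refine ⟨fun hn3 => ?_, fun k hk hkn => ?_, ?_⟩
  · obtain ⟨m, rfl⟩ : ∃ m, n = 1 + m + 1 := ⟨n - 2, by omega⟩
    have h := hS.S_swap_mul_wkij h0 le_rfl (by omega)
    have h1 : rectPermTop 1 m * blockMove 1 (m - 1) (1 - 1) =
        wkij (1 + m + 1 - 1) 1 1 * Equiv.swap 1 (1 + m + 1) := by
      rw [rectPermTop_eq le_rfl, wkij_eq le_rfl (by omega)]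
      simp [blockMove]
    rw [h1] at h
    rw [show 1 + m + 1 - 2 = m by omega]
    rw [show 1 + m - 1 = m by omega] at h
    exact h
  · obtain ⟨m, rfl⟩ : ∃ m, n = k + m + 1 := ⟨n - k - 1, by omega⟩
    have h := hS.S_swap_mul_wkij h0 (by omega) (by omega)
    rw [rectPermTop_mul_blockMove (.inl hk) (by omega) (by omega)] at h
    rw [show k + m + 1 - k - 1 = m by omega, add_comm (S _)]
    exact h
  · obtain ⟨P, rfl⟩ : ∃ P, n = P + 1 + 1 := ⟨n - 2, by omega⟩
    exact hS.S_swap_mul_wkij_one h0 (by omega)
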